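/- Let (v̂_k)_{k ≥ 0} be the functions on [0,1] determined by v̂_0(s) = 0 and the recursion v̂_k(s) = (1 − ĥ_k(s) + s) v̂_{k-1}(s) + ∫_s^{ĥ_k(s)} (1 + v̂_{k-1}(x)) dx, where ĥ_k(s) = min{ s + (2(1-s)/k)^{1/2}, 1 }. Then the maximal residual r̄_k = max_{0 ≤ s ≤ 1} { (2k(1-s))^{1/2} − v̂_k(s) } satisfies r̄_k ≤ 2(log k + 1) for all k ≥ 1. -/

import Mathlib

open MeasureTheory intervalIntegral

/-- The adaptive threshold `ĥ_k(s) = min{ s + (2(1-s)/k)^{1/2}, 1 }`. -/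
noncomputable def hhat (k : ℕ) (s : ℝ) : ℝ :=
  min (s + Real.sqrt (2 * (1 - s) / k)) 1

/-- The residual-difference function `δ_k`. -/
noncomputable def deltaFn (k : ℕ) (s : ℝ) : ℝ :=
  Real.sqrt (2 * k * (1 - s)) - Real.sqrt (2 * ((k:ℝ) - 1) * (1 - s)) +
    ∫ x in s..(hhat k s),
      (Real.sqrt (2 * ((k:ℝ) - 1) * (1 - s)) - Real.sqrt (2 * ((k:ℝ) - 1) * (1 - x)) - 1)

open Set Real

theorem le_hhat {k : ℕ} {s : ℝ} (hs : s ≤ 1) : s ≤ hhat k s :=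
  le_min (le_add_of_nonneg_right (Real.sqrt_nonneg _)) hs

theorem hhat_le_one (k : ℕ) (s : ℝ) : hhat k s ≤ 1 := min_le_right _ _

theorem continuous_hhat (k : ℕ) : Continuous (hhat k) := by
  unfold hhat
  fun_prop

theorem one_sub_sqrt_one_sub_le {t : ℝ} (h0 : 0 ≤ t) (h1 : t ≤ 1) :
    1 - √(1 - t) ≤ t / 2 + t ^ 2 / 2 := by
  have h : 1 - t / 2 - t ^ 2 / 2 ≤ √(1 - t) := by
    apply Real.le_sqrt_of_sq_le
    nlinarith [mul_nonneg (mul_nonneg (sq_nonneg t) (sub_nonneg.2 h1)) h0,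
      mul_nonneg (sq_nonneg t) (sub_nonneg.2 h1),
      mul_nonneg (mul_nonneg (sq_nonneg t) (sub_nonneg.2 h1)) (sq_nonneg t)]
  linarith

theorem sqrt_sub_sqrt_le {m u t : ℝ} (hu : 0 < u) (h0 : 0 ≤ t) (h1 : t ≤ u) :
    √(2 * m * u) - √(2 * m * (u - t)) ≤
      √(2 * m * u) * (t / (2 * u) + t ^ 2 / (2 * u ^ 2)) := by
  have hf : √(2 * m * (u - t)) = √(2 * m * u) * √(1 - t / u) := by
    rw [← Real.sqrt_mul' _ (by rw [sub_nonneg]; exact (div_le_one hu).2 h1)]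
    congr 1
    field_simp
  have h := one_sub_sqrt_one_sub_le (t := t / u) (by positivity) ((div_le_one hu).2 h1)
  calc _ = √(2 * m * u) * (1 - √(1 - t / u)) := by rw [hf]; ring
    _ ≤ √(2 * m * u) * (t / u / 2 + (t / u) ^ 2 / 2) := by gcongr
    _ = _ := by field_simp

theorem integral_sqrt_sub_le {m s h : ℝ} (hs : s < 1) (hsh : s ≤ h) (h1 : h ≤ 1) :
    ∫ x in s..h, (√(2 * m * (1 - s)) - √(2 * m * (1 - x)) - 1) ≤
      √(2 * m * (1 - s)) * ((h - s) ^ 2 / (4 * (1 - s)) + (h - s) ^ 3 / (6 * (1 - s) ^ 2))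
        - (h - s) := by
  have hu : 0 < 1 - s := sub_pos.2 hs
  set A := √(2 * m * (1 - s)) with hA
  have hF : ∀ x ∈ uIcc s h, HasDerivAt
      (fun x => A * ((x - s) ^ 2 / (4 * (1 - s)) + (x - s) ^ 3 / (6 * (1 - s) ^ 2)) - (x - s))
      (A * ((x - s) / (2 * (1 - s)) + (x - s) ^ 2 / (2 * (1 - s) ^ 2)) - 1) x := by
    intro x _
    have hx : HasDerivAt (fun x => x - s) 1 x := (hasDerivAt_id x).sub_const s
    refine HasDerivAt.congr_deriv (((((hx.pow 2).div_const (4 * (1 - s))).add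
      ((hx.pow 3).div_const (6 * (1 - s) ^ 2))).const_mul A).sub hx) ?_
    field_simp
    norm_num
    ring
  have hint := integral_eq_sub_of_hasDerivAt hF
    (Continuous.intervalIntegrable (by fun_prop) _ _)
  calc _ ≤ ∫ x in s..h, (A * ((x - s) / (2 * (1 - s)) + (x - s) ^ 2 / (2 * (1 - s) ^ 2)) - 1) := by
        refine integral_mono_on hsh (Continuous.intervalIntegrable (by fun_prop) _ _)
          (Continuous.intervalIntegrable (by fun_prop) _ _) fun x hx => ?_
        have := sqrt_sub_sqrt_le (m := m) hu (sub_nonneg.2 hx.1)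
          (sub_le_sub_right (hx.2.trans h1) s)
        rw [sub_sub_sub_cancel_right] at this
        linarith
    _ = _ := by rw [hint]; ring

theorem residual_bound_of_interior {p q z : ℝ} (hp : 0 < p) (hq : 0 ≤ q) (hz : 0 < z)
    (hpq : p ^ 2 = q ^ 2 + 1) :
    p * z - q * z + (q * z * ((z / p) ^ 2 / (4 * (z ^ 2 / 2)) +
      (z / p) ^ 3 / (6 * (z ^ 2 / 2) ^ 2)) - z / p) ≤ 2 / p ^ 2 := by
  have hqp : q ≤ p := by nlinarith
  have e : p * z - q * z + (q * z * ((z / p) ^ 2 / (4 * (z ^ 2 / 2)) +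
      (z / p) ^ 3 / (6 * (z ^ 2 / 2) ^ 2)) - z / p) =
      z * (2 * p * (p ^ 2 - 1) - 2 * p ^ 2 * q + q) / (2 * p ^ 2) + 2 / 3 * (q / p) / p ^ 2 := by
    field_simp
    ring
  have e' : 2 * p * (p ^ 2 - 1) - 2 * p ^ 2 * q + q = -(q * (p - q) ^ 2) := by
    linear_combination (2 * p - q) * hpq
  have h1 : z * (2 * p * (p ^ 2 - 1) - 2 * p ^ 2 * q + q) / (2 * p ^ 2) ≤ 0 := by
    rw [e']
    apply div_nonpos_of_nonpos_of_nonneg _ (by positivity)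
    have : 0 ≤ z * (q * (p - q) ^ 2) := by positivity
    linarith
  have h2 : 2 / 3 * (q / p) / p ^ 2 ≤ 2 / p ^ 2 := by
    have : q / p ≤ 1 := (div_le_one hp).2 hqp
    gcongr
    linarith
  linarith

theorem residual_bound_of_boundary {p q z : ℝ} (hp : 0 < p) (hq : 0 ≤ q) (hz : 0 < z)
    (hpq : p ^ 2 = q ^ 2 + 1) (hpz : p * z ≤ 2) :
    p * z - q * z + (q * z * ((z ^ 2 / 2) ^ 2 / (4 * (z ^ 2 / 2)) +
      (z ^ 2 / 2) ^ 3 / (6 * (z ^ 2 / 2) ^ 2)) - z ^ 2 / 2) ≤ 2 / p ^ 2 := by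
  have hqp : q ≤ p := by nlinarith
  have e : p * z - q * z + (q * z * ((z ^ 2 / 2) ^ 2 / (4 * (z ^ 2 / 2)) +
      (z ^ 2 / 2) ^ 3 / (6 * (z ^ 2 / 2) ^ 2)) - z ^ 2 / 2) =
      (p - q) * z - z ^ 2 / 2 + 5 / 24 * (q * z ^ 3) := by
    field_simp
    ring
  rw [e, le_div_iff₀ (by positivity)]
  have h1 : p * (p - q) ≤ 1 := by nlinarith
  have h2 : p * (p - q) * (p * z) ≤ 1 * (p * z) := by gcongr
  have h3 : q * (p ^ 2 * z ^ 3) ≤ p * (p ^ 2 * z ^ 3) := by gcongr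
  have hY : 0 ≤ p * z := by positivity
  set Y := p * z with hYdef
  have e3 : p * (p ^ 2 * z ^ 3) = Y ^ 3 := by rw [hYdef]; ring
  have h4 : Y - Y ^ 2 / 2 + 5 / 24 * Y ^ 3 ≤ 2 := by
    nlinarith [mul_nonneg hY (sub_nonneg.2 hpz), mul_nonneg (mul_nonneg hY hY) (sub_nonneg.2 hpz)]
  have e4 : ((p - q) * z - z ^ 2 / 2 + 5 / 24 * (q * z ^ 3)) * p ^ 2 =
      p * (p - q) * Y - Y ^ 2 / 2 + 5 / 24 * (q * (p ^ 2 * z ^ 3)) := by rw [hYdef]; ring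
  rw [e4]
  linarith

theorem deltaFn_le {k : ℕ} (hk : 1 ≤ k) {s : ℝ} (hs : s ≤ 1) : deltaFn k s ≤ 2 / k := by
  rcases hs.eq_or_lt with rfl | hs
  · have h1 : hhat k 1 = 1 := by simp [hhat]
    simp only [deltaFn, h1, integral_same, sub_self, mul_zero, Real.sqrt_zero, add_zero]
    positivity
  have hk' : (1 : ℝ) ≤ k := by exact_mod_cast hk
  have hint := integral_sqrt_sub_le (m := (k : ℝ) - 1) hs (le_hhat hs.le) (hhat_le_one k s)
  have hu : 0 < 1 - s := sub_pos.2 hs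
  have hp : 0 < √(k : ℝ) := Real.sqrt_pos.2 (by linarith)
  have hz : 0 < √(2 * (1 - s)) := Real.sqrt_pos.2 (by linarith)
  have hq : 0 ≤ √((k : ℝ) - 1) := Real.sqrt_nonneg _
  have hp2 : √(k : ℝ) ^ 2 = k := Real.sq_sqrt (by linarith)
  have hq2 : √((k : ℝ) - 1) ^ 2 = k - 1 := Real.sq_sqrt (by linarith)
  have hz2 : √(2 * (1 - s)) ^ 2 = 2 * (1 - s) := Real.sq_sqrt (by linarith)
  have e1 : √(2 * k * (1 - s)) = √(k : ℝ) * √(2 * (1 - s)) := by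
    rw [← Real.sqrt_mul (by linarith)]; ring_nf
  have e2 : √(2 * ((k : ℝ) - 1) * (1 - s)) = √((k : ℝ) - 1) * √(2 * (1 - s)) := by
    rw [← Real.sqrt_mul (by linarith)]; ring_nf
  have e3 : √(2 * (1 - s) / k) = √(2 * (1 - s)) / √(k : ℝ) := Real.sqrt_div (by linarith) _
  have hd : hhat k s - s = min (√(2 * (1 - s)) / √(k : ℝ)) (1 - s) := by
    rw [hhat, e3, ← min_sub_sub_right, add_sub_cancel_left]
  unfold deltaFn
  refine (add_le_add_right hint _).trans ?_
  rw [hd, e1, e2]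
  generalize √(k : ℝ) = p at *
  generalize √((k : ℝ) - 1) = q at *
  generalize √(2 * (1 - s)) = z at *
  have hzu : 1 - s = z ^ 2 / 2 := by linarith
  rw [hzu, ← hp2]
  rcases le_total (z / p) (z ^ 2 / 2) with h | h
  · rw [min_eq_left h]
    exact residual_bound_of_interior hp hq hz (by linarith)
  · rw [min_eq_right h]
    refine residual_bound_of_boundary hp hq hz (by linarith) ?_
    rw [le_div_iff₀ hp] at h
    by_contra! hc
    nlinarith [mul_pos hz (sub_pos.2 hc)]

theorem ContinuousOn.threshold_step {w : ℝ → ℝ} (hw : ContinuousOn w (Icc 0 1)) (k : ℕ) :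
    ContinuousOn (fun s => (1 - hhat k s + s) * w s + ∫ x in s..(hhat k s), (1 + w x))
      (Icc 0 1) := by
  have hc : ContinuousOn (fun x => 1 + w x) (Icc 0 1) := continuousOn_const.add hw
  have hi : IntervalIntegrable (fun x => 1 + w x) volume 0 1 :=
    ContinuousOn.intervalIntegrable (by rwa [uIcc_of_le zero_le_one])
  have hF : ContinuousOn (fun t => ∫ x in (0 : ℝ)..t, (1 + w x)) (Icc 0 1) := by
    have := continuousOn_primitive_interval' hi left_mem_uIcc
    rwa [uIcc_of_le zero_le_one] at this
  have hm : MapsTo (hhat k) (Icc 0 1) (Icc 0 1) := fun s hs =>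
    ⟨hs.1.trans (le_hhat hs.2), hhat_le_one k s⟩
  have hh := (continuous_hhat k).continuousOn (s := Icc 0 1)
  refine ContinuousOn.add (((continuousOn_const.sub hh).add continuousOn_id).mul hw) ?_
  refine ((hF.comp hh hm).sub hF).congr fun s hs => ?_
  have hsub : ∀ t ∈ Icc (0 : ℝ) 1, IntervalIntegrable (fun x => 1 + w x) volume 0 t :=
    fun t ht => hi.mono_set (uIcc_subset_uIcc left_mem_uIcc (by rwa [uIcc_of_le zero_le_one]))
  exact (integral_interval_sub_left (hsub _ (hm hs)) (hsub _ hs)).symm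

theorem residual_step {w : ℝ → ℝ} {C s : ℝ} {n : ℕ} (hw : ContinuousOn w (Icc 0 1))
    (hC : ∀ x ∈ Icc (0 : ℝ) 1, √(2 * n * (1 - x)) - w x ≤ C) (hs : s ∈ Icc (0 : ℝ) 1) :
    √(2 * (n + 1 : ℕ) * (1 - s)) - ((1 - hhat (n + 1) s + s) * w s +
      ∫ x in s..(hhat (n + 1) s), (1 + w x)) ≤ C + 2 / (n + 1 : ℕ) := by
  have hδ := deltaFn_le (Nat.le_add_left 1 n) hs.2
  have hsh := le_hhat (k := n + 1) hs.2
  have hh1 := hhat_le_one (n + 1) s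
  set h := hhat (n + 1) s with hh
  have hn : ((n + 1 : ℕ) : ℝ) - 1 = n := by push_cast; ring
  unfold deltaFn at hδ
  rw [hn, ← hh] at hδ
  have hsub : uIcc s h ⊆ Icc 0 1 := by
    rw [uIcc_of_le hsh]
    exact Icc_subset_Icc hs.1 hh1
  have hiw : IntervalIntegrable w volume s h := (hw.mono hsub).intervalIntegrable
  have hi1 : IntervalIntegrable (fun x => 1 + w x) volume s h :=
    intervalIntegrable_const.add hiw
  have hi2 : IntervalIntegrable
      (fun x => √(2 * n * (1 - s)) - √(2 * n * (1 - x)) - 1) volume s h :=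
    Continuous.intervalIntegrable (by fun_prop) _ _
  have hmono : ∫ x in s..h, (√(2 * n * (1 - s)) - C) ≤
      ∫ x in s..h, ((1 + w x) + (√(2 * n * (1 - s)) - √(2 * n * (1 - x)) - 1)) := by
    refine integral_mono_on hsh intervalIntegrable_const (hi1.add hi2) fun x hx => ?_
    have := hC x ⟨hs.1.trans hx.1, hx.2.trans hh1⟩
    linarith
  rw [integral_add hi1 hi2, intervalIntegral.integral_const, smul_eq_mul] at hmono
  have hb : (1 - h + s) * (√(2 * n * (1 - s)) - w s) ≤ (1 - h + s) * C :=
    mul_le_mul_of_nonneg_left (hC s hs) (by linarith [hs.1])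
  linarith

/-- the maximal residual `r̄_k = max_{0 ≤ s ≤ 1} {(2k(1-s))^{1/2} − v̂_k(s)}`
satisfies `r̄_k ≤ 2 (log k + 1)` for all `k ≥ 1`. -/
theorem stmt_9 (v : ℕ → ℝ → ℝ)
    (hv0 : ∀ s ∈ Set.Icc (0:ℝ) 1, v 0 s = 0)
    (hv : ∀ k : ℕ, 1 ≤ k → ∀ s ∈ Set.Icc (0:ℝ) 1,
      v k s = (1 - hhat k s + s) * v (k-1) s + ∫ x in s..(hhat k s), (1 + v (k-1) x)) :
    ∀ k : ℕ, 1 ≤ k →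
      sSup ((fun s => Real.sqrt (2 * k * (1 - s)) - v k s) '' Set.Icc (0:ℝ) 1)
        ≤ 2 * (Real.log k + 1) := by
  have key : ∀ n : ℕ, ContinuousOn (v n) (Icc 0 1) ∧
      ∀ s ∈ Icc (0 : ℝ) 1, √(2 * n * (1 - s)) - v n s ≤ 2 * (harmonic n : ℝ) := by
    intro n
    induction n with
    | zero =>
      refine ⟨continuousOn_const.congr hv0, fun s hs => ?_⟩
      simp [hv0 s hs]
    | succ n ih =>
      have hstep := hv (n + 1) (Nat.le_add_left 1 n)
      rw [Nat.add_sub_cancel] at hstep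
      refine ⟨(ih.1.threshold_step (n + 1)).congr hstep, fun s hs => ?_⟩
      rw [hstep s hs]
      refine (residual_step ih.1 ih.2 hs).trans_eq ?_
      rw [harmonic_succ]
      push_cast
      ring
  intro k _
  refine csSup_le ((nonempty_Icc.2 zero_le_one).image _) ?_
  rintro _ ⟨s, hs, rfl⟩
  have := (key k).2 s hs
  have := harmonic_le_one_add_log k
  linarith
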